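/- Let n ≥ 2, d ≥ 1 and 2 ≤ s ≤ C(n−1+d, d) be integers. Then there exists a nonempty Zariski-open subset U of the s-fold product (P^n)^s such that every tuple (p_1,…,p_s) ∈ U consists of distinct points and the quasi-homogeneous fat point scheme Z = d·p_1 + p_2 + ⋯ + p_s satisfies reg(Z) = d. -/

import Mathlib

open MvPolynomial Module

variable {K : Type*} [Field K]

/-- The homogeneous prime ideal of a point of `ℙⁿ`: the ideal generated by the
linear forms vanishing at the point (equivalently, all homogeneous forms vanishing there). -/
noncomputable def pointIdeal {n : ℕ} (p : Projectivization K (Fin (n + 1) → K)) :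
    Ideal (MvPolynomial (Fin (n + 1)) K) :=
  Ideal.span {f | ∃ c : Fin (n + 1) → K,
    (∑ i, c i * p.rep i) = 0 ∧ f = ∑ i, MvPolynomial.C (c i) * MvPolynomial.X i}

/-- The saturated ideal `I_Z = 𝔭₁^{m₁} ∩ ⋯ ∩ 𝔭_s^{m_s}` of the fat point scheme
`Z = Σ m_i p_i`.  (Points with multiplicity `0` contribute the unit ideal.) -/
noncomputable def fatIdeal {n s : ℕ} (p : Fin s → Projectivization K (Fin (n + 1) → K))
    (m : Fin s → ℕ) : Ideal (MvPolynomial (Fin (n + 1)) K) :=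
  ⨅ i, pointIdeal (p i) ^ m i

/-- `dim_K (R/I)_d`: the dimension of the degree-`d` graded piece of `R/I`,
computed as the dimension of the image of the degree-`d` forms in `R/I`. -/
noncomputable def hilbDim {n : ℕ} (I : Ideal (MvPolynomial (Fin (n + 1)) K)) (d : ℕ) : ℕ :=
  Module.finrank K (Submodule.map (Ideal.Quotient.mkₐ K I).toLinearMap
    (homogeneousSubmodule (Fin (n + 1)) K d))

/-- `Σ_i C(n + m_i − 1, n)`, the expected degree (number of conditions) of a fat point
scheme with multiplicities `m` in `ℙⁿ`. -/
def expDeg {s : ℕ} (n : ℕ) (m : Fin s → ℕ) : ℕ := ∑ i, Nat.choose (n + m i - 1) n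

/-- `h¹(I_Z(d)) = 0`, i.e. the fat point scheme imposes independent conditions on
degree-`d` forms. -/
def H1Zero {n s : ℕ} (p : Fin s → Projectivization K (Fin (n + 1) → K)) (m : Fin s → ℕ)
    (d : ℕ) : Prop :=
  hilbDim (fatIdeal p m) d = expDeg n m

/-- The regularity index of the fat point scheme `Z = Σ m_i p_i`: the least `d ≥ 0`
with `h¹(I_Z(d)) = 0`. -/
noncomputable def regIndex {n s : ℕ} (p : Fin s → Projectivization K (Fin (n + 1) → K))
    (m : Fin s → ℕ) : ℕ :=
  sInf {d | H1Zero p m d}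

/-- The set of points of `ℙⁿ` lying in the linear subspace `P(V)`. -/
def projSet {n : ℕ} (V : Submodule K (Fin (n + 1) → K)) :
    Set (Projectivization K (Fin (n + 1) → K)) :=
  {x | x.rep ∈ V}

open Classical in
/-- `w_L(Z)`: the sum of the multiplicities of the points of `Z` lying in `L`. -/
noncomputable def weightIn {n s : ℕ} (p : Fin s → Projectivization K (Fin (n + 1) → K))
    (m : Fin s → ℕ) (L : Set (Projectivization K (Fin (n + 1) → K))) : ℕ :=
  ∑ i, if p i ∈ L then m i else 0

/-- A polynomial in the `s·(n+1)` cone variables of `(ℙⁿ)ˢ` is multihomogeneous if it is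
homogeneous separately in each of the `s` blocks of variables; the non-vanishing of such a
polynomial at a tuple of representatives is independent of the chosen representatives, so
its non-vanishing locus is a (basic) Zariski-open subset of `(ℙⁿ)ˢ`. -/
def MultiHomog {s n : ℕ} (f : MvPolynomial (Fin s × Fin (n + 1)) K) : Prop :=
  ∃ dd : Fin s → ℕ, ∀ u ∈ f.support, ∀ i : Fin s, (∑ j : Fin (n + 1), u (i, j)) = dd i

/-- Evaluation of a polynomial in the cone variables at the representatives of a tuple of
points of `ℙⁿ`. -/
noncomputable def evalAtReps {n s : ℕ} (p : Fin s → Projectivization K (Fin (n + 1) → K))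
    (f : MvPolynomial (Fin s × Fin (n + 1)) K) : K :=
  MvPolynomial.eval (fun v => (p v.1).rep v.2) f


section Evaluation

theorem LinearIndependent.exists_det_ne_zero {ι X : Type*} [Fintype ι] [DecidableEq ι]
    {h : ι → X → K} (hh : LinearIndependent K h) :
    ∃ q : ι → X, (Matrix.of fun i k => h k (q i)).det ≠ 0 := by
  set S : Set (ι → K) := Set.range fun x k => h k x
  have hS : Submodule.span K S = ⊤ := by
    by_contra hne
    obtain ⟨f, hf, hle⟩ := Submodule.exists_le_ker_of_lt_top _ (lt_top_iff_ne_top.2 hne)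
    have hz : ∀ k, f (Pi.single k 1) = 0 := by
      refine Fintype.linearIndependent_iff.1 hh _ (funext fun x => ?_)
      have hx := hle (Submodule.subset_span ⟨x, rfl⟩)
      beta_reduce at hx
      rw [LinearMap.mem_ker, pi_eq_sum_univ' fun k => h k x, map_sum] at hx
      rw [Finset.sum_apply, Pi.zero_apply]
      refine Eq.trans ?_ hx
      refine Finset.sum_congr rfl fun k _ => ?_
      rw [Pi.smul_apply, map_smul, smul_eq_mul, smul_eq_mul, mul_comm]
    exact hf (LinearMap.pi_ext' fun k => LinearMap.ext_ring (by simpa using hz k))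
  obtain ⟨g, hg, -, hli⟩ := Submodule.exists_fun_fin_finrank_span_eq K S
  have hc : Fintype.card ι = finrank K (Submodule.span K S) := by
    rw [hS, finrank_top, Module.finrank_fintype_fun_eq_card]
  let e : ι ≃ Fin (finrank K (Submodule.span K S)) := Fintype.equivFinOfCardEq hc
  choose q hq using hg
  refine ⟨fun i => q (e i), ?_⟩
  have hrow : LinearIndependent K (Matrix.of fun i k => h k (q (e i))).row := by
    have : (Matrix.of fun i k => h k (q (e i))).row = g ∘ e := funext fun i => hq (e i)
    exact this ▸ hli.comp e e.injective
  exact ((Matrix.isUnit_iff_isUnit_det _).1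
    (Matrix.linearIndependent_rows_iff_isUnit.1 hrow)).ne_zero

theorem MvPolynomial.aeval_mul_of_isHomogeneous {σ : Type*} {A : Type*} [CommRing A] [Algebra K A]
    {f : MvPolynomial σ K} {d : ℕ}
    (hf : f.IsHomogeneous d) (x : σ → K) (t : A) :
    aeval (fun i => algebraMap K A (x i) * t) f = algebraMap K A (eval x f) * t ^ d := by
  rw [aeval_def, eval₂_eq, eval_eq, map_sum, Finset.sum_mul]
  refine Finset.sum_congr rfl fun u hu => ?_
  simp only [mul_pow, Finset.prod_mul_distrib, map_mul, map_prod, map_pow]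
  rw [Finset.prod_pow_eq_pow_sum, ← mul_assoc]
  congr 2
  have := hf.degree_eq_sum_deg_support hu
  simpa [Finsupp.degree] using this.symm

theorem Finsupp.natCard_degree_eq (m d : ℕ) :
    Nat.card {u : Fin m →₀ ℕ // u.degree = d} = (m + d - 1).choose d := by
  have h := Nat.card_congr (Sym.equivNatSum (Fin m) d)
  rw [Sym.natCard_sym_eq_choose, Nat.card_fin] at h
  exact h.symm

theorem MvPolynomial.finrank_homogeneousSubmodule (m d : ℕ) :
    finrank K (homogeneousSubmodule (Fin m) K d) = (m + d - 1).choose d := by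
  rw [homogeneousSubmodule_eq_finsupp_supported, ← restrictSupport,
    Module.finrank_eq_nat_card_basis (basisRestrictSupport K {u : Fin m →₀ ℕ | u.degree = d})]
  exact Finsupp.natCard_degree_eq m d

theorem MvPolynomial.homogeneousComponent_mul_of_isHomogeneous {σ : Type*} {d : ℕ}
    (f : MvPolynomial σ K) {g : MvPolynomial σ K} (hg : g.IsHomogeneous d) :
    homogeneousComponent d (f * g) = C (constantCoeff f) * g := by
  classical
  induction f using MvPolynomial.induction_on' with
  | monomial u a =>
    have h1 : (monomial u a * g).IsHomogeneous (u.degree + d) :=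
      (isHomogeneous_monomial a rfl).mul hg
    rw [homogeneousComponent_of_mem h1]
    by_cases hu : u = 0
    · subst hu
      simp [← C_apply]
    · have : u.degree ≠ 0 := by rwa [Ne, Finsupp.degree_eq_zero_iff]
      rw [if_neg (by omega)]
      simp [constantCoeff_monomial, hu]
  | add p q hp hq => simp [add_mul, hp, hq]

end Evaluation

section PolarForms

variable {n : ℕ}

/-- The linear forms `a₀ X_{j+1} - a_{j+1} X₀`, which cut out the point `a` when `a₀ ≠ 0`. -/
noncomputable def polarForm (a : Fin (n + 1) → K) (j : Fin n) : MvPolynomial (Fin (n + 1)) K :=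
  C (a 0) * X j.succ - C (a j.succ) * X 0

theorem polarForm_isHomogeneous (a : Fin (n + 1) → K) (j : Fin n) :
    (polarForm a j).IsHomogeneous 1 :=
  (isHomogeneous_C_mul_X _ _).sub (isHomogeneous_C_mul_X _ _)

/-- Projection from the point `a` to `ℙⁿ⁻¹`, in coordinates. -/
def polarPoint {A : Type*} [CommRing A] (a x : Fin (n + 1) → A) (j : Fin n) : A :=
  a 0 * x j.succ - a j.succ * x 0

theorem eval_polarForm (a x : Fin (n + 1) → K) (j : Fin n) :
    eval x (polarForm a j) = polarPoint a x j := by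
  simp [polarForm, polarPoint]

theorem eval_aeval_polarForm (a x : Fin (n + 1) → K) (g : MvPolynomial (Fin n) K) :
    eval x (aeval (polarForm a) g) = eval (polarPoint a x) g := by
  rw [aeval_def, ← coe_eval₂Hom, ← RingHom.comp_apply, comp_eval₂Hom, coe_eval₂Hom, eval,
    coe_eval₂Hom]
  congr 1
  · ext r
    simp [algebraMap_eq]
  · exact funext fun j => eval_polarForm a x j

theorem aeval_polarForm_injective {a : Fin (n + 1) → K} (ha : a 0 ≠ 0) :
    Function.Injective (aeval (R := K) (polarForm a)) := by
  let r : MvPolynomial (Fin (n + 1)) K →ₐ[K] MvPolynomial (Fin n) K :=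
    aeval (Fin.cons 0 fun j => C (a 0)⁻¹ * X j)
  have h : (r.comp (aeval (polarForm a))) = AlgHom.id K _ := by
    refine algHom_ext fun j => ?_
    simp only [AlgHom.comp_apply, aeval_X, polarForm, r, map_sub, map_mul, algHom_C,
      algebraMap_eq, Fin.cons_succ, Fin.cons_zero, mul_zero, sub_zero, AlgHom.id_apply]
    rw [← mul_assoc, ← C_mul, mul_inv_cancel₀ ha, C_1, one_mul]
  exact Function.LeftInverse.injective (g := r) fun x => by
    simpa using DFunLike.congr_fun h x

theorem pointIdeal_eq_span_polarForm {p : Projectivization K (Fin (n + 1) → K)}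
    (hp : p.rep 0 ≠ 0) : pointIdeal p = Ideal.span (Set.range (polarForm p.rep)) := by
  refine le_antisymm (Ideal.span_le.2 ?_) (Ideal.span_le.2 ?_)
  · rintro f ⟨c, hc, rfl⟩
    have h : ∑ i, C (c i) * X i =
        ∑ j : Fin n, C (c j.succ * (p.rep 0)⁻¹) * polarForm p.rep j := by
      have h0 : c 0 = - ∑ j : Fin n, c j.succ * (p.rep 0)⁻¹ * p.rep j.succ := by
        rw [Fin.sum_univ_succ] at hc
        have : c 0 = - (∑ j : Fin n, c j.succ * p.rep j.succ) * (p.rep 0)⁻¹ := by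
          field_simp
          linear_combination hc
        rw [this, neg_mul, Finset.sum_mul]
        exact congrArg _ (Finset.sum_congr rfl fun j _ => by ring)
      rw [Fin.sum_univ_succ, h0]
      rw [map_neg, map_sum, neg_mul, Finset.sum_mul, neg_add_eq_sub, ← Finset.sum_sub_distrib]
      refine Finset.sum_congr rfl fun j _ => ?_
      have h1 : (C (p.rep 0)⁻¹ * C (p.rep 0) : MvPolynomial (Fin (n + 1)) K) = 1 := by
        rw [← C_mul, inv_mul_cancel₀ hp, C_1]
      simp only [polarForm, C_mul]
      linear_combination - C (c j.succ) * X j.succ * h1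
    rw [SetLike.mem_coe, h]
    exact Ideal.sum_mem _ fun j _ => Ideal.mul_mem_left _ _ (Ideal.subset_span ⟨j, rfl⟩)
  · rintro f ⟨j, rfl⟩
    refine Ideal.subset_span ⟨Pi.single j.succ (p.rep 0) - Pi.single 0 (p.rep j.succ), ?_, ?_⟩
    · simp [sub_mul, Finset.sum_sub_distrib, Pi.single_apply, mul_comm (p.rep 0)]
    · simp [polarForm, sub_mul, Finset.sum_sub_distrib, Pi.single_apply, apply_ite C]

theorem mem_pointIdeal_pow_iff {p : Projectivization K (Fin (n + 1) → K)} (hp : p.rep 0 ≠ 0)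
    {d : ℕ} {f : MvPolynomial (Fin (n + 1)) K} (hf : f.IsHomogeneous d) :
    f ∈ pointIdeal p ^ d ↔
      ∃ g : MvPolynomial (Fin n) K, g.IsHomogeneous d ∧ aeval (polarForm p.rep) g = f := by
  rw [pointIdeal_eq_span_polarForm hp, Ideal.mem_span_pow_iff_exists_isHomogeneous]
  constructor
  · rintro ⟨P, hP, rfl⟩
    refine ⟨map constantCoeff P, hP.map _, ?_⟩
    rw [← homogeneousComponent_eq_self hf, eval_eq, map_sum, aeval_def, eval₂_map, eval₂_eq]
    refine Finset.sum_congr rfl fun u hu => ?_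
    rw [homogeneousComponent_mul_of_isHomogeneous]
    · simp
    · rw [hP.degree_eq_sum_deg_support hu]
      have := MvPolynomial.IsHomogeneous.prod u.support (fun j => polarForm p.rep j ^ u j)
        (fun j => u j) fun j _ => by simpa using (polarForm_isHomogeneous p.rep j).pow (u j)
      exact this
  · rintro ⟨g, hg, rfl⟩
    exact ⟨map C g, hg.map _, by rw [eval_map, aeval_def, algebraMap_eq]⟩

theorem mem_pointIdeal_iff (p : Projectivization K (Fin (n + 1) → K))
    {d : ℕ} {f : MvPolynomial (Fin (n + 1)) K} (hf : f.IsHomogeneous d) :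
    f ∈ pointIdeal p ↔ eval p.rep f = 0 := by
  constructor
  · intro h
    have : pointIdeal p ≤ RingHom.ker (eval p.rep) := by
      refine Ideal.span_le.2 ?_
      rintro _ ⟨c, hc, rfl⟩
      simpa [RingHom.mem_ker] using hc
    exact this h
  · intro h
    obtain ⟨k, hk⟩ := Function.ne_iff.1 p.rep_nonzero
    rw [Pi.zero_apply] at hk
    set t : MvPolynomial (Fin (n + 1)) K := C (p.rep k)⁻¹ * X k
    have hX : ∀ i, Ideal.Quotient.mkₐ K (pointIdeal p) (X i) =
        algebraMap K _ (p.rep i) * Ideal.Quotient.mkₐ K (pointIdeal p) t := by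
      intro i
      rw [← AlgHom.commutes (Ideal.Quotient.mkₐ K (pointIdeal p)), ← map_mul,
        Ideal.Quotient.mkₐ_eq_mk, Ideal.Quotient.eq]
      refine Ideal.subset_span ⟨Pi.single i 1 - Pi.single k (p.rep i * (p.rep k)⁻¹), ?_, ?_⟩
      · simp [sub_mul, Finset.sum_sub_distrib, Pi.single_apply, hk]
      · simp [t, sub_mul, Finset.sum_sub_distrib, Pi.single_apply, apply_ite C, algebraMap_eq,
          mul_assoc]
    have := aeval_mul_of_isHomogeneous hf p.rep (Ideal.Quotient.mkₐ K (pointIdeal p) t)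
    rw [h, map_zero, zero_mul] at this
    rw [← Ideal.Quotient.eq_zero_iff_mem, ← Ideal.Quotient.mkₐ_eq_mk K, ← this]
    conv_lhs => rw [← aeval_X_left_apply f, ← AlgHom.comp_apply, comp_aeval]
    simp_rw [hX]

end PolarForms

section HilbertFunction

variable {n : ℕ}

theorem hilbDim_add_finrank_ker (I : Ideal (MvPolynomial (Fin (n + 1)) K)) (d : ℕ) :
    hilbDim I d + finrank K (LinearMap.ker ((Ideal.Quotient.mkₐ K I).toLinearMap.domRestrict
      (homogeneousSubmodule (Fin (n + 1)) K d))) = (n + d).choose d := by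
  have : FiniteDimensional K (homogeneousSubmodule (Fin (n + 1)) K d) :=
    Module.Finite.iff_fg.2 (homogeneousSubmodule_fg _ _ d)
  rw [hilbDim, ← LinearMap.range_domRestrict, LinearMap.finrank_range_add_finrank_ker,
    finrank_homogeneousSubmodule]
  congr 1
  omega

theorem expDeg_quasiHomogeneous {s : ℕ} (i₀ : Fin s) (n d : ℕ) :
    expDeg n (fun i => if i = i₀ then d else 1) = (n + d - 1).choose n + (s - 1) := by
  rw [expDeg, ← Finset.add_sum_erase _ _ (Finset.mem_univ i₀), if_pos rfl]
  congr 1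
  rw [Finset.sum_congr rfl fun i hi => by
    rw [if_neg (Finset.ne_of_mem_erase hi), Nat.add_sub_cancel, Nat.choose_self]]
  simp

theorem H1Zero_quasiHomogeneous {s : ℕ} {p : Fin s → Projectivization K (Fin (n + 1) → K)}
    {i₀ : Fin s} {d : ℕ} (hd : 1 ≤ d) (hp : (p i₀).rep 0 ≠ 0)
    {κ : {i // i ≠ i₀} → (Fin n →₀ ℕ)} (hκ : ∀ i, (κ i).degree = d)
    (hdet : (Matrix.of fun i k : {i // i ≠ i₀} =>
      eval (polarPoint (p i₀).rep (p i).rep) (monomial (κ k) (1 : K))).det ≠ 0) :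
    H1Zero p (fun i => if i = i₀ then d else 1) d := by
  set M := Matrix.of fun i k : {i // i ≠ i₀} =>
      eval (polarPoint (p i₀).rep (p i).rep) (monomial (κ k) (1 : K)) with hM
  have hfin : FiniteDimensional K (homogeneousSubmodule (Fin n) K d) :=
    Module.Finite.iff_fg.2 (homogeneousSubmodule_fg _ _ d)
  let E : homogeneousSubmodule (Fin n) K d →ₗ[K] ({i // i ≠ i₀} → K) :=
    LinearMap.pi fun i =>
      (aeval (polarPoint (p i₀).rep (p i).rep)).toLinearMap ∘ₗ Submodule.subtype _
  have hE : LinearMap.range E = ⊤ := by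
    refine LinearMap.range_eq_top.2 fun y => ?_
    refine ⟨∑ k, (M⁻¹.mulVec y) k • ⟨monomial (κ k) (1 : K), isHomogeneous_monomial _ (hκ k)⟩, ?_⟩
    rw [map_sum]
    have hy : M.mulVec (M⁻¹.mulVec y) = y := by
      rw [Matrix.mulVec_mulVec, Matrix.mul_nonsing_inv _ hdet.isUnit, Matrix.one_mulVec]
    conv_rhs => rw [← hy]
    funext i
    rw [Finset.sum_apply, Matrix.mulVec, dotProduct]
    refine Finset.sum_congr rfl fun k _ => ?_
    rw [map_smul, Pi.smul_apply, smul_eq_mul, mul_comm]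
    rfl
  let Φ : homogeneousSubmodule (Fin n) K d →ₗ[K] homogeneousSubmodule (Fin (n + 1)) K d :=
    (aeval (polarForm (p i₀).rep)).toLinearMap.restrict fun g hg => by
      have h := MvPolynomial.IsHomogeneous.aeval hg _ (polarForm_isHomogeneous (p i₀).rep)
      rwa [one_mul] at h
  have hΦ : Function.Injective Φ := fun x y hxy =>
    Subtype.ext (aeval_polarForm_injective hp (congrArg Subtype.val hxy))
  set I := fatIdeal p fun i => if i = i₀ then d else 1 with hI
  have hmem : ∀ f : MvPolynomial (Fin (n + 1)) K, f ∈ I ↔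
      f ∈ pointIdeal (p i₀) ^ d ∧ ∀ i : {i // i ≠ i₀}, f ∈ pointIdeal (p i) := by
    intro f
    rw [hI, fatIdeal, Ideal.mem_iInf]
    constructor
    · intro h
      exact ⟨by simpa using h i₀, fun i => by simpa [i.2] using h i⟩
    · rintro ⟨h0, h1⟩ i
      by_cases hi : i = i₀
      · simpa [hi] using h0
      · simpa [hi] using h1 ⟨i, hi⟩
  have hker : LinearMap.ker ((Ideal.Quotient.mkₐ K I).toLinearMap.domRestrict
      (homogeneousSubmodule (Fin (n + 1)) K d)) = (LinearMap.ker E).map Φ := by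
    ext ⟨f, hf⟩
    rw [LinearMap.mem_ker, LinearMap.domRestrict_apply, AlgHom.toLinearMap_apply,
      Ideal.Quotient.mkₐ_eq_mk, Ideal.Quotient.eq_zero_iff_mem, hmem,
      mem_pointIdeal_pow_iff hp hf, Submodule.mem_map]
    simp_rw [mem_pointIdeal_iff _ hf]
    constructor
    · rintro ⟨⟨g, hg, rfl⟩, h⟩
      refine ⟨⟨g, hg⟩, ?_, rfl⟩
      rw [LinearMap.mem_ker]
      funext i
      exact (eval_aeval_polarForm _ _ g).symm.trans (h i)
    · rintro ⟨⟨g, hg⟩, h, hgf⟩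
      have hgf' : aeval (polarForm (p i₀).rep) g = f := congrArg Subtype.val hgf
      subst hgf'
      refine ⟨⟨g, hg, rfl⟩, fun i => ?_⟩
      rw [eval_aeval_polarForm]
      exact congrFun (LinearMap.mem_ker.1 h) i
  have h1 := hilbDim_add_finrank_ker I d
  have h2 := E.finrank_range_add_finrank_ker
  rw [hker, ← (Submodule.equivMapOfInjective Φ hΦ _).finrank_eq] at h1
  rw [hE, finrank_top, Module.finrank_fintype_fun_eq_card, finrank_homogeneousSubmodule,
    Fintype.card_subtype_compl, Fintype.card_fin, Fintype.card_unique] at h2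
  rw [H1Zero, expDeg_quasiHomogeneous i₀ n d, ← hI]
  obtain ⟨e, rfl⟩ := Nat.exists_eq_add_of_le' hd
  have h3 : (n + (e + 1) - 1).choose n = (n + e).choose e := by
    rw [Nat.add_succ_sub_one]
    exact Nat.choose_symm_add
  have h4 := Nat.choose_succ_succ (n + e) e
  simp only [Nat.succ_eq_add_one, ← Nat.add_assoc, Nat.add_sub_cancel] at *
  omega

theorem not_H1Zero_of_lt {s : ℕ} (p : Fin s → Projectivization K (Fin (n + 1) → K))
    (i₀ : Fin s) {d e : ℕ} (hs : 2 ≤ s) (he : e < d) :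
    ¬ H1Zero p (fun i => if i = i₀ then d else 1) e := by
  rw [H1Zero, expDeg_quasiHomogeneous i₀ n d]
  have h1 := hilbDim_add_finrank_ker (fatIdeal p fun i => if i = i₀ then d else 1) e
  have h2 : (n + e).choose n ≤ (n + d - 1).choose n := Nat.choose_le_choose n (by omega)
  have h3 : (n + e).choose n = (n + e).choose e := Nat.choose_symm_add
  omega

end HilbertFunction

section GenericDeterminant

variable {n s : ℕ}

theorem MultiHomog.of_isWeightedHomogeneous {f : MvPolynomial (Fin s × Fin (n + 1)) K}
    {D : Fin s → ℕ}
    (hf : f.IsWeightedHomogeneous (fun v => (Pi.single v.1 1 : Fin s → ℕ)) D) :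
    MultiHomog f := by
  refine ⟨D, fun u hu i => ?_⟩
  rw [← hf (mem_support_iff.1 hu), Finsupp.weight_apply, Finsupp.sum_fintype _ _ (by simp),
    Fintype.sum_prod_type, Finset.sum_apply, Finset.sum_eq_single i]
  · simp
  · intro j _ hj
    simp [hj.symm]
  · simp

theorem MvPolynomial.IsWeightedHomogeneous.det {σ W ι : Type*} [AddCommMonoid W] [Fintype ι]
    [DecidableEq ι] {w : σ → W} {A : Matrix ι ι (MvPolynomial σ K)} {D : ι → W}
    (hA : ∀ i k, (A i k).IsWeightedHomogeneous w (D i)) :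
    A.det.IsWeightedHomogeneous w (∑ i, D i) := by
  rw [Matrix.det_apply]
  refine IsWeightedHomogeneous.sum _ _ _ fun τ _ => ?_
  rw [Units.smul_def]
  refine zsmul_mem (K := weightedHomogeneousSubmodule K w (∑ i, D i)) ?_ _
  rw [← Equiv.sum_comp τ D]
  exact IsWeightedHomogeneous.prod _ _ _ fun i _ => hA (τ i) i

/-- The universal evaluation determinant of the monomials `κ` at the projections from the
`i₀`-th point of the remaining points. -/
noncomputable def genericDet (K : Type*) [Field K] {s n : ℕ} (i₀ : Fin s)
    (κ : {i // i ≠ i₀} → (Fin n →₀ ℕ)) : MvPolynomial (Fin s × Fin (n + 1)) K :=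
  (Matrix.of fun i k : {i // i ≠ i₀} =>
    aeval (polarPoint (fun j => X (i₀, j)) fun j => X (i.1, j)) (monomial (κ k) (1 : K))).det

theorem genericDet_isWeightedHomogeneous {i₀ : Fin s} {κ : {i // i ≠ i₀} → (Fin n →₀ ℕ)} {d : ℕ}
    (hκ : ∀ i, (κ i).degree = d) :
    (genericDet K i₀ κ).IsWeightedHomogeneous (fun v => (Pi.single v.1 1 : Fin s → ℕ))
      (∑ i : {i // i ≠ i₀}, d • (Pi.single i₀ 1 + Pi.single i.1 1 : Fin s → ℕ)) := by
  refine IsWeightedHomogeneous.det fun i k => ?_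
  rw [Matrix.of_apply, aeval_monomial, map_one, one_mul, ← hκ k, Finsupp.degree_eq_sum,
    Finset.sum_smul, Finsupp.prod_fintype _ _ (by simp)]
  refine IsWeightedHomogeneous.prod _ _ _ fun j _ => IsWeightedHomogeneous.pow ?_ _
  refine IsWeightedHomogeneous.sub ?_ ?_ <;>
  exact (isWeightedHomogeneous_X K _ _).mul (isWeightedHomogeneous_X K _ _)

theorem eval_genericDet {i₀ : Fin s} {κ : {i // i ≠ i₀} → (Fin n →₀ ℕ)}
    (v : Fin s → Fin (n + 1) → K) :
    eval (fun z => v z.1 z.2) (genericDet K i₀ κ) =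
      (Matrix.of fun i k : {i // i ≠ i₀} =>
        eval (polarPoint (v i₀) (v i)) (monomial (κ k) (1 : K))).det := by
  rw [genericDet, RingHom.map_det]
  congr 1
  ext i k
  rw [RingHom.mapMatrix_apply, Matrix.map_apply, Matrix.of_apply, Matrix.of_apply,
    aeval_monomial, eval_monomial]
  simp [Finsupp.prod, polarPoint]

/-- Nonvanishing of the evaluation determinant forces the points to be distinct. -/
theorem injective_of_det_eval_polarPoint_ne_zero {i₀ : Fin s} {κ : {i // i ≠ i₀} → (Fin n →₀ ℕ)} {d : ℕ}
    (hd : 1 ≤ d) (hκ : ∀ i, (κ i).degree = d) {α : Type*} {p : Fin s → α}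
    {r : α → Fin (n + 1) → K}
    (h : (Matrix.of fun i k : {i // i ≠ i₀} =>
        eval (polarPoint (r (p i₀)) (r (p i))) (monomial (κ k) (1 : K))).det ≠ 0) :
    Function.Injective p := by
  have key : ∀ i : {i // i ≠ i₀}, p i ≠ p i₀ := by
    intro i hi
    refine h (Matrix.det_eq_zero_of_row_eq_zero i fun k => ?_)
    have hz : polarPoint (r (p i₀)) (r (p i₀)) = 0 := by
      funext j
      simp [polarPoint, mul_comm]
    have hk : κ k ≠ 0 := by
      intro h0
      have := hκ k
      rw [h0, map_zero] at this
      omega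
    obtain ⟨j, hj⟩ := Finsupp.support_nonempty_iff.2 hk
    rw [Matrix.of_apply, hi, hz, eval_monomial, one_mul]
    exact Finset.prod_eq_zero hj (by simpa using hj)
  intro i j hij
  by_contra hne
  by_cases hi : i = i₀
  · subst hi
    exact key ⟨j, fun h => hne h.symm⟩ hij.symm
  by_cases hj : j = i₀
  · subst hj
    exact key ⟨i, hi⟩ hij
  refine h (Matrix.det_zero_of_row_eq (i := ⟨i, hi⟩) (j := ⟨j, hj⟩) (by simpa using hne) ?_)
  funext k
  simp only [Matrix.of_apply, hij]

theorem exists_eval_genericDet_ne_zero [Infinite K] {i₀ : Fin s}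
    {κ : {i // i ≠ i₀} → (Fin n →₀ ℕ)} (hκi : Function.Injective κ) {d : ℕ}
    (hκ : ∀ i, (κ i).degree = d) :
    ∃ p : Fin s → Projectivization K (Fin (n + 1) → K), (p i₀).rep 0 ≠ 0 ∧
      (Matrix.of fun i k : {i // i ≠ i₀} =>
        eval (polarPoint (p i₀).rep (p i).rep) (monomial (κ k) (1 : K))).det ≠ 0 := by
  have hli : LinearIndependent K fun (k : {i // i ≠ i₀}) (q : Fin n → K) =>
      eval q (monomial (κ k) (1 : K)) := by
    let ev : MvPolynomial (Fin n) K →ₗ[K] ((Fin n → K) → K) :=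
      LinearMap.pi fun q => (aeval q).toLinearMap
    refine (((basisMonomials (Fin n) K).linearIndependent.comp κ hκi).map' ev ?_)
    refine LinearMap.ker_eq_bot'.2 fun f hf => MvPolynomial.funext fun q => ?_
    rw [map_zero]
    exact congrFun hf q
  obtain ⟨q, hq⟩ := hli.exists_det_ne_zero
  let y : Fin s → Fin n → K := fun i => if h : i = i₀ then 0 else q ⟨i, h⟩
  let x : Fin s → Fin (n + 1) → K := fun i => Fin.cons 1 (y i)
  have hx : ∀ i, x i ≠ 0 := fun i h => one_ne_zero (congrFun h 0)
  choose c hc using fun i => Projectivization.exists_smul_eq_mk_rep K (x i) (hx i)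
  refine ⟨fun i => Projectivization.mk K (x i) (hx i), ?_, ?_⟩
  · simp [← hc, x, Units.smul_def]
  · have hpol : ∀ i : {i // i ≠ i₀}, polarPoint (c i₀ • x i₀) (c i • x i) =
        fun j => q i j * ((c i₀ : K) * c i) := by
      intro i
      funext j
      simp [polarPoint, x, y, i.2, Units.smul_def]
      ring
    have hmat : (Matrix.of fun i k : {i // i ≠ i₀} =>
        eval (polarPoint (c i₀ • x i₀) (c i • x i)) (monomial (κ k) (1 : K))) =
        Matrix.of fun i k : {i // i ≠ i₀} => ((c i₀ : K) * c i) ^ d *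
          (Matrix.of fun i k : {i // i ≠ i₀} => eval (q i) (monomial (κ k) (1 : K))) i k := by
      ext i k
      have := aeval_mul_of_isHomogeneous (isHomogeneous_monomial (1 : K) (hκ k)) (q i)
        ((c i₀ : K) * c i)
      simp only [Matrix.of_apply, hpol]
      rw [mul_comm (_ ^ d)]
      exact this
    simp only [← hc]
    rw [hmat, Matrix.det_mul_column]
    exact mul_ne_zero (Finset.prod_ne_zero_iff.2 fun i _ =>
      pow_ne_zero _ (mul_ne_zero (c i₀).ne_zero (c i).ne_zero)) hq

end GenericDeterminant

theorem exists_injective_degree_eq {s n d : ℕ} (i₀ : Fin s) (hn : 1 ≤ n)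
    (hs : s ≤ Nat.choose (n - 1 + d) d) :
    ∃ κ : {i // i ≠ i₀} → (Fin n →₀ ℕ), Function.Injective κ ∧ ∀ i, (κ i).degree = d := by
  have hcard := Finsupp.natCard_degree_eq n d
  rw [show n + d - 1 = n - 1 + d by omega] at hcard
  have hpos : 0 < s := i₀.pos
  have : Finite {u : Fin n →₀ ℕ // u.degree = d} := Nat.finite_of_card_ne_zero (by omega)
  have := Fintype.ofFinite {u : Fin n →₀ ℕ // u.degree = d}
  rw [Nat.card_eq_fintype_card] at hcard
  obtain ⟨κ⟩ := Function.Embedding.nonempty_of_card_le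
    (α := {i // i ≠ i₀}) (β := {u : Fin n →₀ ℕ // u.degree = d})
    ((Fintype.card_subtype_le _).trans (by rw [hcard, Fintype.card_fin]; exact hs))
  exact ⟨fun i => (κ i).1, Subtype.val_injective.comp κ.injective, fun i => (κ i).2⟩

/-- **Quasi-homogeneous case.**  Let `n ≥ 2`, `d ≥ 1` and `2 ≤ s ≤ C(n−1+d, d)`.  Then for
`s` points of `ℙⁿ` in general position (all tuples in a nonempty basic Zariski-open subset
of `(ℙⁿ)ˢ`) the points are distinct and the quasi-homogeneous fat point scheme
`Z = d·p₁ + p₂ + ⋯ + p_s` has regularity index exactly `d`. -/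
theorem quasi_homogeneous_reg {K : Type*} [Field K] [IsAlgClosed K] {n d s : ℕ}
    (hn : 2 ≤ n) (hd : 1 ≤ d) (hs : 2 ≤ s) (hs' : s ≤ Nat.choose (n - 1 + d) d) :
    ∃ f : MvPolynomial (Fin s × Fin (n + 1)) K, MultiHomog f ∧
      (∃ p : Fin s → Projectivization K (Fin (n + 1) → K), evalAtReps p f ≠ 0) ∧
      ∀ p : Fin s → Projectivization K (Fin (n + 1) → K), evalAtReps p f ≠ 0 →
        Function.Injective p ∧
        regIndex p (fun i => if i = ⟨0, by omega⟩ then d else 1) = d := by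
  set i₀ : Fin s := ⟨0, by omega⟩
  obtain ⟨κ, hκi, hκ⟩ := exists_injective_degree_eq i₀ (by omega) hs'
  have heval : ∀ p : Fin s → Projectivization K (Fin (n + 1) → K),
      evalAtReps p (X (i₀, 0) * genericDet K i₀ κ) = (p i₀).rep 0 *
        (Matrix.of fun i k : {i // i ≠ i₀} =>
          eval (polarPoint (p i₀).rep (p i).rep) (monomial (κ k) (1 : K))).det := by
    intro p
    rw [evalAtReps, map_mul, eval_X, eval_genericDet fun i => (p i).rep]
  refine ⟨X (i₀, 0) * genericDet K i₀ κ, .of_isWeightedHomogeneous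
    ((isWeightedHomogeneous_X K _ _).mul (genericDet_isWeightedHomogeneous hκ)), ?_, ?_⟩
  · have : Infinite K := IsAlgClosed.instInfinite
    obtain ⟨p, hp, hdet⟩ := exists_eval_genericDet_ne_zero (K := K) hκi hκ
    exact ⟨p, by rw [heval]; exact mul_ne_zero hp hdet⟩
  · intro p hp
    rw [heval] at hp
    obtain ⟨hp0, hdet⟩ := mul_ne_zero_iff.1 hp
    have h := H1Zero_quasiHomogeneous hd hp0 hκ hdet
    refine ⟨injective_of_det_eval_polarPoint_ne_zero hd hκ hdet,
      le_antisymm (Nat.sInf_le h) (le_csInf ⟨d, h⟩ fun e he => ?_)⟩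
    by_contra hlt
    exact not_H1Zero_of_lt p i₀ hs (not_le.1 hlt) he
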